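/- arXiv:1805.12464 — 2 statements merged into one kernel-verified Lean document; each statement's English description precedes it below -/
import Mathlib

section
/- Symmetric sum theorem for interpolated quasi-shuffle products: for letters u₁,…,u_n in a quasi-shuffle algebra, Σ_{σ∈S_n} u_{σ(1)}u_{σ(2)}⋯u_{σ(n)} = Σ_{B={B₁,…,B_l}∈Π_n} c_r(B) · u_{B₁} ∗_r u_{B₂} ∗_r ⋯ ∗_r u_{B_l}, where u_{B_i} = ⋄-product of the u_j for j ∈ B_i, and c_r(B) = (−1)^{n−l} ∏_{m=1}^{l} (|B_m|−1)! · p_{|B_m|}(r) with p_a(r) = (1−r)^a − (−r)^a. -/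
/-!
Quasi-shuffle algebras (Hoffman–Ihara).  We model the span `kA` of the alphabet
(with its commutative associative product `⋄`, written `*` in `L`) as a
non-unital commutative `k`-algebra `L`, and the word algebra `k⟨A⟩` as the
tensor algebra `TensorAlgebra k L`, in which a word `a₁⋯aₙ` is the product
`ι a₁ * ⋯ * ι aₙ`.
-/

open TensorAlgebra

variable (k : Type*) [Field k]
variable {L : Type*} [NonUnitalCommRing L] [Module k L]
  [SMulCommClass k L L] [IsScalarTower k L L]

/-- The word `a₁⋯aₙ` as an element of the tensor algebra. -/
def word (l : List L) : TensorAlgebra k L := (l.map fun a => TensorAlgebra.ι k a).prod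

/-- The `⋄`-product of the letters of a nonempty block (junk value `0` on `[]`). -/
def blockProd : List L → L
  | [] => 0
  | a :: t => t.foldl (· * ·) a

/-- Iterated product `x₁ ∗ x₂ ∗ ⋯ ∗ x_l` of a list (empty product `1`). -/
def iterProd {M : Type*} [One M] (f : M → M → M) : List M → M
  | [] => 1
  | [x] => x
  | x :: y :: t => f x (iterProd f (y :: t))

/-- The set partitions of `Fin n`, as the finset of families of nonempty
pairwise disjoint finsets covering `Fin n`. -/
def setPartitions (n : ℕ) : Finset (Finset (Finset (Fin n))) :=
  Finset.univ.filter fun P =>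
    (∅ : Finset (Fin n)) ∉ P ∧ P.sup id = Finset.univ ∧
      ∀ s ∈ P, ∀ t ∈ P, s ≠ t → Disjoint s t

namespace SymSum

theorem word_nil {k : Type*} [Field k] {L : Type*} [NonUnitalCommRing L] [Module k L] :
    word k ([] : List L) = 1 := by simp [word]

theorem word_cons {k : Type*} [Field k] {L : Type*} [NonUnitalCommRing L] [Module k L]
    (a : L) (v : List L) : word k (a :: v) = TensorAlgebra.ι k a * word k v := by simp [word]

theorem word_append {k : Type*} [Field k] {L : Type*} [NonUnitalCommRing L] [Module k L]
    (v w : List L) : word k (v ++ w) = word k v * word k w := by simp [word]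

theorem mem_span_word {k : Type*} [Field k] {L : Type*} [NonUnitalCommRing L] [Module k L]
    (x : TensorAlgebra k L) : x ∈ Submodule.span k (Set.range (word k (L := L))) := by
  induction x using TensorAlgebra.induction with
  | algebraMap c =>
    rw [Algebra.algebraMap_eq_smul_one]
    exact Submodule.smul_mem _ _ (Submodule.subset_span ⟨[], word_nil⟩)
  | ι a => exact Submodule.subset_span ⟨[a], by simp [word]⟩
  | add x y hx hy => exact Submodule.add_mem _ hx hy
  | mul x y hx hy =>
    have h := Submodule.mul_mem_mul hx hy
    rw [Submodule.span_mul_span] at h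
    refine Submodule.span_mono ?_ h
    rintro _ ⟨_, ⟨v, rfl⟩, _, ⟨w, rfl⟩, rfl⟩
    exact ⟨v ++ w, word_append v w⟩

theorem ext_word {k : Type*} [Field k] {L : Type*} [NonUnitalCommRing L] [Module k L]
    {M : Type*} [AddCommGroup M] [Module k M] {f g : TensorAlgebra k L →ₗ[k] M}
    (h : ∀ v : List L, f (word k v) = g (word k v)) (x : TensorAlgebra k L) : f x = g x := by
  have : Set.EqOn f g (Submodule.span k (Set.range (word k (L := L)))) :=
    LinearMap.eqOn_span (by rintro _ ⟨v, rfl⟩; exact h v)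
  exact this (mem_span_word x)

theorem ext_rec {k : Type*} [Field k] {L : Type*} [NonUnitalCommRing L] [Module k L]
    {M : Type*} [AddCommGroup M] [Module k M] {f g : TensorAlgebra k L →ₗ[k] M}
    (h1 : f 1 = g 1)
    (h : ∀ (c : L) (x : TensorAlgebra k L), f x = g x →
      f (TensorAlgebra.ι k c * x) = g (TensorAlgebra.ι k c * x))
    (x : TensorAlgebra k L) : f x = g x := by
  refine ext_word (fun v => ?_) x
  induction v with
  | nil => rw [word_nil, h1]
  | cons a v ih => rw [word_cons]; exact h _ _ ih

theorem exists_op {k : Type*} [Field k] {L : Type*} [NonUnitalCommRing L] [Module k L]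
    (φ : L →ₗ[k] TensorAlgebra k L →ₗ[k] TensorAlgebra k L) (e : TensorAlgebra k L) :
    ∃ O : TensorAlgebra k L →ₗ[k] TensorAlgebra k L, O 1 = e ∧
      ∀ c x, O (TensorAlgebra.ι k c * x) = φ c x + TensorAlgebra.ι k c * O x := by
  let A := TensorAlgebra k L
  let ψ : L →ₗ[k] Module.End k (A × A) :=
    { toFun := fun c => LinearMap.prod
        ((LinearMap.mulLeft k (TensorAlgebra.ι k c)) ∘ₗ LinearMap.fst k A A)
        (φ c ∘ₗ LinearMap.fst k A A
          + (LinearMap.mulLeft k (TensorAlgebra.ι k c)) ∘ₗ LinearMap.snd k A A)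
      map_add' := by
        intro a b
        refine LinearMap.ext fun x => Prod.ext ?_ ?_
        · simp [add_mul]
        · simp [add_mul]; abel
      map_smul' := by
        intro a b
        refine LinearMap.ext fun x => Prod.ext ?_ ?_ <;> simp }
  have hψ : ∀ c p, ψ c p = (TensorAlgebra.ι k c * p.1, φ c p.1 + TensorAlgebra.ι k c * p.2) :=
    fun c p => rfl
  let Φ := TensorAlgebra.lift k ψ
  let ev : Module.End k (A × A) →ₗ[k] A × A := LinearMap.applyₗ (1, e)
  have hfst : ∀ x : A, (Φ x (1, e)).1 = x := by
    intro x
    refine ext_rec (f := LinearMap.fst k A A ∘ₗ ev ∘ₗ Φ.toLinearMap) (g := LinearMap.id) ?_ ?_ x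
    · simp [ev]
    · intro c x hx
      have hx' : (Φ x (1, e)).1 = x := hx
      change (Φ (TensorAlgebra.ι k c * x) (1, e)).1 = TensorAlgebra.ι k c * x
      rw [map_mul, TensorAlgebra.lift_ι_apply, Module.End.mul_apply, hψ, hx']
  refine ⟨LinearMap.snd k A A ∘ₗ ev ∘ₗ Φ.toLinearMap, ?_, ?_⟩
  · simp [ev]
  · intro c x
    change (Φ (TensorAlgebra.ι k c * x) (1, e)).2 = φ c x + TensorAlgebra.ι k c * (Φ x (1, e)).2
    rw [map_mul, TensorAlgebra.lift_ι_apply, Module.End.mul_apply, hψ, hfst]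

section ops

variable {k : Type*} [Field k] {L : Type*} [NonUnitalCommRing L] [Module k L]
  {I J Λ D : L → TensorAlgebra k L →ₗ[k] TensorAlgebra k L} {p q : k}

theorem I_comm
    (hI1 : ∀ a, I a 1 = TensorAlgebra.ι k a)
    (hI : ∀ a c x, I a (TensorAlgebra.ι k c * x)
      = TensorAlgebra.ι k a * (TensorAlgebra.ι k c * x) + TensorAlgebra.ι k c * I a x)
    (a b : L) (x : TensorAlgebra k L) : I a (I b x) = I b (I a x) := by
  have hI1' : ∀ a c, I a (TensorAlgebra.ι k c)
      = TensorAlgebra.ι k a * TensorAlgebra.ι k c + TensorAlgebra.ι k c * TensorAlgebra.ι k a := by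
    intro a c; have := hI a c 1; rwa [mul_one, hI1] at this
  refine ext_rec (f := I a ∘ₗ I b) (g := I b ∘ₗ I a) ?_ ?_ x
  · simp only [LinearMap.comp_apply, hI1, hI1']; abel
  · intro c x hx
    simp only [LinearMap.comp_apply] at hx
    simp only [LinearMap.comp_apply, hI, map_add, hx, mul_add]; abel

theorem J_I
    (hI1 : ∀ a, I a 1 = TensorAlgebra.ι k a)
    (hI : ∀ a c x, I a (TensorAlgebra.ι k c * x)
      = TensorAlgebra.ι k a * (TensorAlgebra.ι k c * x) + TensorAlgebra.ι k c * I a x)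
    (hJ1 : ∀ a, J a 1 = 0)
    (hJ : ∀ a c x, J a (TensorAlgebra.ι k c * x)
      = TensorAlgebra.ι k (a * c) * x + TensorAlgebra.ι k c * J a x)
    (b c : L) (x : TensorAlgebra k L) : J b (I c x) = I c (J b x) + I (b * c) x := by
  have hJ1' : ∀ a c, J a (TensorAlgebra.ι k c) = TensorAlgebra.ι k (a * c) := by
    intro a c; have := hJ a c 1; rwa [mul_one, hJ1, mul_zero, add_zero, mul_one] at this
  refine ext_rec (f := J b ∘ₗ I c) (g := I c ∘ₗ J b + I (b * c)) ?_ ?_ x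
  · simp [hI1, hJ1, hJ1']
  · intro d x hx
    simp only [LinearMap.comp_apply, LinearMap.add_apply] at hx
    simp only [LinearMap.comp_apply, LinearMap.add_apply, hI, hJ, map_add, hx, mul_add]; abel

theorem D_I
    (hI1 : ∀ a, I a 1 = TensorAlgebra.ι k a)
    (hI : ∀ a c x, I a (TensorAlgebra.ι k c * x)
      = TensorAlgebra.ι k a * (TensorAlgebra.ι k c * x) + TensorAlgebra.ι k c * I a x)
    (hD1 : ∀ a, D a 1 = 0)
    (hD : ∀ a c x, D a (TensorAlgebra.ι k c * x) = TensorAlgebra.ι k (a * c) * x)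
    (e c : L) (x : TensorAlgebra k L) :
    D e (I c x) = TensorAlgebra.ι k (e * c) * x + I c (D e x) - TensorAlgebra.ι k c * D e x := by
  have hD1' : ∀ a c, D a (TensorAlgebra.ι k c) = TensorAlgebra.ι k (a * c) := by
    intro a c; have := hD a c 1; rwa [mul_one, mul_one] at this
  refine ext_rec (f := D e ∘ₗ I c)
    (g := LinearMap.mulLeft k (TensorAlgebra.ι k (e * c)) + I c ∘ₗ D e
      - LinearMap.mulLeft k (TensorAlgebra.ι k c) ∘ₗ D e) ?_ ?_ x
  · simp [hI1, hD1, hD1']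
  · intro d x hx
    simp only [LinearMap.comp_apply, LinearMap.add_apply, LinearMap.sub_apply,
      LinearMap.mulLeft_apply, hI, hD, map_add]; abel

theorem Λ_I
    (hI1 : ∀ a, I a 1 = TensorAlgebra.ι k a)
    (hI : ∀ a c x, I a (TensorAlgebra.ι k c * x)
      = TensorAlgebra.ι k a * (TensorAlgebra.ι k c * x) + TensorAlgebra.ι k c * I a x)
    (hJ1 : ∀ a, J a 1 = 0)
    (hJ : ∀ a c x, J a (TensorAlgebra.ι k c * x)
      = TensorAlgebra.ι k (a * c) * x + TensorAlgebra.ι k c * J a x)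
    (hD1 : ∀ a, D a 1 = 0)
    (hD : ∀ a c x, D a (TensorAlgebra.ι k c * x) = TensorAlgebra.ι k (a * c) * x)
    (hΛ1 : ∀ a, Λ a 1 = TensorAlgebra.ι k a)
    (hΛ : ∀ a c x, Λ a (TensorAlgebra.ι k c * x)
      = TensorAlgebra.ι k a * (TensorAlgebra.ι k c * x) + TensorAlgebra.ι k c * Λ a x
        + p • (TensorAlgebra.ι k (a * c) * x) + q • D (a * c) x)
    (b c : L) (x : TensorAlgebra k L) :
    Λ b (I c x) = I c (Λ b x) + p • I (b * c) x + (2 * q) • J (b * c) x := by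
  have hΛ1' : ∀ a c, Λ a (TensorAlgebra.ι k c)
      = TensorAlgebra.ι k a * TensorAlgebra.ι k c + TensorAlgebra.ι k c * TensorAlgebra.ι k a
        + p • TensorAlgebra.ι k (a * c) := by
    intro a c; have := hΛ a c 1
    rwa [mul_one, mul_one, hΛ1, hD1, smul_zero, add_zero] at this
  have hI1' : ∀ a c, I a (TensorAlgebra.ι k c)
      = TensorAlgebra.ι k a * TensorAlgebra.ι k c + TensorAlgebra.ι k c * TensorAlgebra.ι k a := by
    intro a c; have := hI a c 1; rwa [mul_one, hI1] at this
  refine ext_rec (f := Λ b ∘ₗ I c)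
    (g := I c ∘ₗ Λ b + p • I (b * c) + (2 * q) • J (b * c)) ?_ ?_ x
  · simp only [LinearMap.comp_apply, LinearMap.add_apply, LinearMap.smul_apply, hI1, hJ1, hΛ1,
      hΛ1', hI1', smul_zero]
    abel
  · intro d x hx
    simp only [LinearMap.comp_apply, LinearMap.add_apply, LinearMap.smul_apply] at hx
    have e : b * d * c = b * c * d := mul_right_comm b d c
    simp only [LinearMap.comp_apply, LinearMap.add_apply, LinearMap.smul_apply, hI, hJ, hD, hΛ,
      map_add, map_smul, hx, mul_add, D_I hI1 hI hD1 hD, e, mul_smul_comm, smul_add,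
      smul_sub]
    module

theorem Λ_aux
    (hD1 : ∀ a, D a 1 = 0)
    (hD : ∀ a c x, D a (TensorAlgebra.ι k c * x) = TensorAlgebra.ι k (a * c) * x)
    (hΛ1 : ∀ a, Λ a 1 = TensorAlgebra.ι k a)
    (hΛ : ∀ a c x, Λ a (TensorAlgebra.ι k c * x)
      = TensorAlgebra.ι k a * (TensorAlgebra.ι k c * x) + TensorAlgebra.ι k c * Λ a x
        + p • (TensorAlgebra.ι k (a * c) * x) + q • D (a * c) x)
    (a b c : L) (x : TensorAlgebra k L) :
    D (a * c) (Λ b x) + Λ a (D (b * c) x) + TensorAlgebra.ι k b * D (a * c) x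
      = D (b * c) (Λ a x) + Λ b (D (a * c) x) + TensorAlgebra.ι k a * D (b * c) x := by
  have hD1' : ∀ a c, D a (TensorAlgebra.ι k c) = TensorAlgebra.ι k (a * c) := by
    intro a c; have := hD a c 1; rwa [mul_one, mul_one] at this
  have hDD : ∀ a b c d x, a * b = c * d → D a (D b x) = D c (D d x) := by
    intro a b c d x h
    refine ext_rec (f := D a ∘ₗ D b) (g := D c ∘ₗ D d) ?_ ?_ x
    · simp [hD1]
    · intro f x _
      simp only [LinearMap.comp_apply, hD, ← mul_assoc, h]
  have hDD' : ∀ a b x, D a (D b x) = D b (D a x) := fun a b x => hDD _ _ _ _ x (mul_comm _ _)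
  refine ext_rec (f := D (a * c) ∘ₗ Λ b + Λ a ∘ₗ D (b * c)
      + LinearMap.mulLeft k (TensorAlgebra.ι k b) ∘ₗ D (a * c))
    (g := D (b * c) ∘ₗ Λ a + Λ b ∘ₗ D (a * c)
      + LinearMap.mulLeft k (TensorAlgebra.ι k a) ∘ₗ D (b * c)) ?_ ?_ x
  · simp only [LinearMap.comp_apply, LinearMap.add_apply, LinearMap.mulLeft_apply, hD1, hΛ1,
      hD1', map_zero, mul_zero, add_zero, mul_right_comm a c b, mul_right_comm b c a, mul_comm a b]
  · intro d x _
    have e1 : a * (b * c * d) = b * (a * c * d) := by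
      rw [← mul_assoc, ← mul_assoc, ← mul_assoc, ← mul_assoc, mul_comm a b]
    have e2 : a * c * (b * d) = b * (a * c * d) := by
      rw [mul_left_comm]
    have e3 : b * c * (a * d) = b * (a * c * d) := by
      rw [mul_assoc, mul_left_comm c a d, ← mul_assoc a]
    have e4 : b * c * a = a * c * b := by
      rw [mul_right_comm, mul_comm b a, mul_right_comm]
    simp only [LinearMap.comp_apply, LinearMap.add_apply, LinearMap.mulLeft_apply, hD, hΛ,
      map_add, map_smul, e1, e2, e3, e4, hDD (a * c) (b * d) (b * c) (a * d) x (by rw [e2, e3])]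
    module

theorem Λ_comm
    (hD1 : ∀ a, D a 1 = 0)
    (hD : ∀ a c x, D a (TensorAlgebra.ι k c * x) = TensorAlgebra.ι k (a * c) * x)
    (hΛ1 : ∀ a, Λ a 1 = TensorAlgebra.ι k a)
    (hΛ : ∀ a c x, Λ a (TensorAlgebra.ι k c * x)
      = TensorAlgebra.ι k a * (TensorAlgebra.ι k c * x) + TensorAlgebra.ι k c * Λ a x
        + p • (TensorAlgebra.ι k (a * c) * x) + q • D (a * c) x)
    (a b : L) (x : TensorAlgebra k L) : Λ a (Λ b x) = Λ b (Λ a x) := by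
  have hΛ1' : ∀ a c, Λ a (TensorAlgebra.ι k c)
      = TensorAlgebra.ι k a * TensorAlgebra.ι k c + TensorAlgebra.ι k c * TensorAlgebra.ι k a
        + p • TensorAlgebra.ι k (a * c) := by
    intro a c; have := hΛ a c 1
    rwa [mul_one, mul_one, hΛ1, hD1, smul_zero, add_zero] at this
  refine ext_rec (f := Λ a ∘ₗ Λ b) (g := Λ b ∘ₗ Λ a) ?_ ?_ x
  · simp only [LinearMap.comp_apply, hΛ1, hΛ1', mul_comm a b]; abel
  · intro c x hx
    simp only [LinearMap.comp_apply] at hx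
    have h := congrArg (fun y => q • y) (Λ_aux hD1 hD hΛ1 hΛ a b c x)
    simp only [smul_add] at h
    have e : b * (a * c) = a * (b * c) := mul_left_comm _ _ _
    have e' : b * a = a * b := mul_comm _ _
    simp only [LinearMap.comp_apply, hΛ, hD, map_add, map_smul, hx, mul_add, smul_add,
      mul_smul_comm, e, e']
    linear_combination (norm := module) h

end ops

section comb

variable {k : Type*} [Field k] {L : Type*} [NonUnitalCommRing L] [Module k L]
  {I J Λ : L → TensorAlgebra k L →ₗ[k] TensorAlgebra k L} {p q : k}
  {α : Type*} [DecidableEq α]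

theorem exists_fold {β M : Type*} (f : β → M → M) (hf : ∀ a b x, f a (f b x) = f b (f a x))
    (e : M) : ∃ S : Multiset β → M, S 0 = e ∧ (∀ a s, S (a ::ₘ s) = f a (S s)) := by
  haveI : LeftCommutative f := ⟨hf⟩
  exact ⟨Multiset.foldr f e, by simp, by simp⟩

theorem erase_insert_of_mem {a j : α} {s : Finset α} (ha : a ∉ s) (hj : j ∈ s) :
    (insert a s).erase j = insert a (s.erase j) := by
  rw [Finset.erase_insert_of_ne]
  rintro rfl; exact ha hj

theorem J_S {S : Finset α → TensorAlgebra k L} {u : α → L}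
    (hIc : ∀ a b x, I a (I b x) = I b (I a x))
    (hJI : ∀ b c x, J b (I c x) = I c (J b x) + I (b * c) x)
    (hJ1 : ∀ a, J a 1 = 0)
    (hS0 : S ∅ = 1) (hS : ∀ a s, a ∉ s → S (insert a s) = I (u a) (S s))
    (s : Finset α) (b : L) : J b (S s) = ∑ j ∈ s, I (b * u j) (S (s.erase j)) := by
  induction s using Finset.induction_on with
  | empty => simp [hS0, hJ1]
  | insert a s ha ih =>
    rw [hS a s ha, hJI, ih, Finset.sum_insert ha, Finset.erase_insert ha, add_comm, map_sum]
    congr 1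
    refine Finset.sum_congr rfl fun j hj => ?_
    rw [erase_insert_of_mem ha hj, hS _ _ (by simp [ha]), hIc]

theorem Λ_S {S : Finset α → TensorAlgebra k L} {u : α → L}
    (hIc : ∀ a b x, I a (I b x) = I b (I a x))
    (hJI : ∀ b c x, J b (I c x) = I c (J b x) + I (b * c) x)
    (hI1 : ∀ a, I a 1 = TensorAlgebra.ι k a)
    (hJ1 : ∀ a, J a 1 = 0)
    (hΛ1 : ∀ a, Λ a 1 = TensorAlgebra.ι k a)
    (hΛI : ∀ b c x, Λ b (I c x) = I c (Λ b x) + p • I (b * c) x + (2 * q) • J (b * c) x)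
    (hS0 : S ∅ = 1) (hS : ∀ a s, a ∉ s → S (insert a s) = I (u a) (S s))
    (s : Finset α) (b : L) :
    Λ b (S s) = I b (S s) + p • J b (S s) + q • ∑ j ∈ s, J (b * u j) (S (s.erase j)) := by
  induction s using Finset.induction_on with
  | empty => simp [hS0, hJ1, hI1, hΛ1]
  | insert a s ha ih =>
    have h1 : ∑ j ∈ s, J (b * u j) (S ((insert a s).erase j))
        = I (u a) (∑ j ∈ s, J (b * u j) (S (s.erase j))) + J (b * u a) (S s) := by
      rw [J_S hIc hJI hJ1 hS0 hS s, map_sum, ← Finset.sum_add_distrib]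
      refine Finset.sum_congr rfl fun j hj => ?_
      rw [erase_insert_of_mem ha hj, hS _ _ (by simp [ha]), hJI, mul_right_comm]
    rw [Finset.sum_insert ha, Finset.erase_insert ha, h1, hS a s ha, hΛI, ih, hJI, hIc b]
    simp only [map_add, map_smul]
    module

/-- Moving one element from the complement into the subset. -/
theorem sum_move {M : Type*} [AddCommGroup M] [Module k M] (V : Finset α) (H : ℕ → k)
    (G : Finset α → M) :
    ∑ C ∈ V.powerset, ∑ j ∈ V \ C, H C.card • G (insert j C)
      = ∑ C ∈ V.powerset, ((C.card : k) * H (C.card - 1)) • G C := by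
  have : ∀ C ∈ V.powerset, ((C.card : k) * H (C.card - 1)) • G C
      = ∑ j ∈ C, H (C.card - 1) • G C := by
    intro C _
    rw [Finset.sum_const, ← Nat.cast_smul_eq_nsmul k, smul_smul]
  rw [Finset.sum_congr rfl this, Finset.sum_sigma', Finset.sum_sigma']
  refine Finset.sum_bij' (fun x _ => ⟨insert x.2 x.1, x.2⟩) (fun x _ => ⟨x.1.erase x.2, x.2⟩)
    ?_ ?_ ?_ ?_ ?_
  · rintro ⟨C, j⟩ h
    simp only [Finset.mem_sigma, Finset.mem_powerset, Finset.mem_sdiff] at h ⊢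
    exact ⟨Finset.insert_subset h.2.1 h.1, Finset.mem_insert_self _ _⟩
  · rintro ⟨C, j⟩ h
    simp only [Finset.mem_sigma, Finset.mem_powerset, Finset.mem_sdiff] at h ⊢
    exact ⟨(Finset.erase_subset _ _).trans h.1, h.1 h.2, Finset.notMem_erase _ _⟩
  · rintro ⟨C, j⟩ h
    simp only [Finset.mem_sigma, Finset.mem_powerset, Finset.mem_sdiff] at h
    simp [Finset.erase_insert h.2.2]
  · rintro ⟨C, j⟩ h
    simp only [Finset.mem_sigma, Finset.mem_powerset] at h
    simp [Finset.insert_erase h.2]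
  · rintro ⟨C, j⟩ h
    simp only [Finset.mem_sigma, Finset.mem_powerset, Finset.mem_sdiff] at h
    simp [Finset.card_insert_of_notMem h.2.2]

/-- The main recursion for symmetric sums. -/
theorem S_rec {S : Finset α → TensorAlgebra k L} {u : α → L} {U : Finset α → L} {d : ℕ → k}
    (hIc : ∀ a b x, I a (I b x) = I b (I a x))
    (hJI : ∀ b c x, J b (I c x) = I c (J b x) + I (b * c) x)
    (hI1 : ∀ a, I a 1 = TensorAlgebra.ι k a)
    (hJ1 : ∀ a, J a 1 = 0)
    (hΛ1 : ∀ a, Λ a 1 = TensorAlgebra.ι k a)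
    (hΛI : ∀ b c x, Λ b (I c x) = I c (Λ b x) + p • I (b * c) x + (2 * q) • J (b * c) x)
    (hS0 : S ∅ = 1) (hS : ∀ a s, a ∉ s → S (insert a s) = I (u a) (S s))
    (hU1 : ∀ a, U {a} = u a)
    (hU : ∀ a s, s.Nonempty → a ∉ s → U (insert a s) = U s * u a)
    (hd0 : d 0 = 1)
    (hd : ∀ t : ℕ, d (t + 1) + p * ((t + 1 : ℕ) * d t)
      + q * ((t + 1 : ℕ) * (t * d (t - 1))) = 0)
    (V : Finset α) (a : α) (ha : a ∉ V) :
    S (insert a V) = ∑ C ∈ V.powerset, d C.card • Λ (U (insert a C)) (S (V \ C)) := by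
  let G : Finset α → TensorAlgebra k L := fun C => I (U (insert a C)) (S (V \ C))
  have hUj : ∀ C ⊆ V, ∀ j ∈ V \ C, U (insert a C) * u j = U (insert a (insert j C)) := by
    intro C hC j hj
    rw [Finset.mem_sdiff] at hj
    rw [Finset.insert_comm, hU _ _ (Finset.insert_nonempty _ _)]
    rw [Finset.mem_insert, not_or]
    exact ⟨by rintro rfl; exact ha hj.1, hj.2⟩
  have hsd : ∀ C j, (V \ C).erase j = V \ insert j C := by
    intro C j; ext x; simp only [Finset.mem_erase, Finset.mem_sdiff, Finset.mem_insert]; tauto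
  have hJG : ∀ C ⊆ V, J (U (insert a C)) (S (V \ C)) = ∑ j ∈ V \ C, G (insert j C) := by
    intro C hC
    rw [J_S hIc hJI hJ1 hS0 hS]
    refine Finset.sum_congr rfl fun j hj => ?_
    rw [hUj C hC j hj, hsd]
  have key : ∀ C ∈ V.powerset, d C.card • Λ (U (insert a C)) (S (V \ C))
      = d C.card • G C + p • ∑ j ∈ V \ C, d C.card • G (insert j C)
        + q • ∑ j ∈ V \ C, d C.card • ∑ i ∈ V \ insert j C, G (insert i (insert j C)) := by
    intro C hC
    rw [Finset.mem_powerset] at hC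
    rw [Λ_S hIc hJI hI1 hJ1 hΛ1 hΛI hS0 hS, hJG C hC]
    have : ∑ j ∈ V \ C, J (U (insert a C) * u j) (S ((V \ C).erase j))
        = ∑ j ∈ V \ C, ∑ i ∈ V \ insert j C, G (insert i (insert j C)) := by
      refine Finset.sum_congr rfl fun j hj => ?_
      rw [hUj C hC j hj, hsd, hJG]
      exact Finset.insert_subset (Finset.mem_sdiff.1 hj).1 hC
    rw [this]
    simp only [smul_add, ← Finset.smul_sum, G]
    module
  rw [Finset.sum_congr rfl key, Finset.sum_add_distrib, Finset.sum_add_distrib,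
    ← Finset.smul_sum, ← Finset.smul_sum, sum_move V d G,
    sum_move V d (fun C => ∑ i ∈ V \ C, G (insert i C))]
  have h2 : ∑ C ∈ V.powerset, ((C.card : k) * d (C.card - 1)) • ∑ i ∈ V \ C, G (insert i C)
      = ∑ C ∈ V.powerset, ((C.card : k) * (((C.card - 1 : ℕ) : k) * d (C.card - 1 - 1))) • G C := by
    rw [← sum_move V (fun t => (t : k) * d (t - 1)) G]
    simp only [Finset.smul_sum]
  rw [h2, Finset.smul_sum, Finset.smul_sum, ← Finset.sum_add_distrib, ← Finset.sum_add_distrib]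
  rw [Finset.sum_eq_single ∅]
  · simp [G, hd0, hU1, hS a V ha]
  · intro C _ hC
    obtain ⟨t, ht⟩ : ∃ t, C.card = t + 1 :=
      ⟨C.card - 1, by have := Finset.card_pos.2 (Finset.nonempty_iff_ne_empty.2 hC); omega⟩
    rw [smul_smul, smul_smul, ← add_smul, ← add_smul, ht, Nat.add_sub_cancel, hd, zero_smul]
  · simp

theorem S_first {S : Finset α → TensorAlgebra k L} {u : α → L}
    (hI1 : ∀ a, I a 1 = TensorAlgebra.ι k a)
    (hI : ∀ a c x, I a (TensorAlgebra.ι k c * x)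
      = TensorAlgebra.ι k a * (TensorAlgebra.ι k c * x) + TensorAlgebra.ι k c * I a x)
    (hS0 : S ∅ = 1) (hS : ∀ a s, a ∉ s → S (insert a s) = I (u a) (S s))
    (s : Finset α) (hs : s.Nonempty) :
    S s = ∑ j ∈ s, TensorAlgebra.ι k (u j) * S (s.erase j) := by
  induction s using Finset.induction_on with
  | empty => simp at hs
  | insert a s ha ih =>
    rw [Finset.sum_insert ha, Finset.erase_insert ha, hS a s ha]
    rcases s.eq_empty_or_nonempty with rfl | h
    · simp [hS0, hI1]
    · have h1 : ∑ j ∈ s, TensorAlgebra.ι k (u j) * S ((insert a s).erase j)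
          = ∑ j ∈ s, TensorAlgebra.ι k (u j) * I (u a) (S (s.erase j)) :=
        Finset.sum_congr rfl fun j hj => by
          rw [erase_insert_of_mem ha hj, hS _ _ (by simp [ha])]
      rw [h1]
      conv_lhs => rw [ih h]
      conv_rhs => rw [ih h]
      rw [map_sum, Finset.mul_sum, ← Finset.sum_add_distrib]
      exact Finset.sum_congr rfl fun j _ => hI _ _ _

theorem mem_lst {s : Finset α} {l : List α} :
    l ∈ s.val.lists.toFinset ↔ s.val = (l : Multiset α) := by
  rw [Multiset.mem_toFinset, Multiset.mem_lists_iff]; rfl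

theorem S_lists {S : Finset α → TensorAlgebra k L} {u : α → L}
    (hS0 : S ∅ = 1)
    (hSf : ∀ s : Finset α, s.Nonempty →
      S s = ∑ j ∈ s, TensorAlgebra.ι k (u j) * S (s.erase j)) (s : Finset α) :
    S s = ∑ l ∈ s.val.lists.toFinset, word k (l.map u) := by
  induction s using Finset.strongInduction with
  | H s ih =>
    rcases s.eq_empty_or_nonempty with rfl | h
    · rw [hS0]
      have : ((∅ : Finset α).val.lists.toFinset) = {[]} := by
        ext l; simp [mem_lst, eq_comm]
      rw [this]; simp [word]
    · rw [hSf s h]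
      have : ∀ j ∈ s, TensorAlgebra.ι k (u j) * S (s.erase j)
          = ∑ l ∈ (s.erase j).val.lists.toFinset, word k ((j :: l).map u) := by
        intro j hj
        rw [ih _ (Finset.erase_ssubset hj), Finset.mul_sum]
        simp [word]
      rw [Finset.sum_congr rfl this, Finset.sum_sigma']
      refine Finset.sum_bij (fun x _ => x.1 :: x.2) ?_ ?_ ?_ ?_
      · rintro ⟨j, l⟩ hx
        simp only [Finset.mem_sigma, mem_lst] at hx ⊢
        rw [Finset.erase_val] at hx
        rw [← Multiset.cons_coe, ← hx.2]
        exact (Multiset.cons_erase hx.1).symm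
      · rintro ⟨j, l⟩ _ ⟨j', l'⟩ _ h
        simp only [List.cons.injEq] at h
        obtain ⟨rfl, rfl⟩ := h; rfl
      · intro l hl
        rw [mem_lst] at hl
        rcases l with _ | ⟨j, l⟩
        · exfalso
          have : s = ∅ := Finset.val_eq_zero.1 (by simpa using hl)
          exact h.ne_empty this
        · refine ⟨⟨j, l⟩, ?_, rfl⟩
          simp only [Finset.mem_sigma, mem_lst]
          rw [Finset.erase_val]
          rw [← Multiset.cons_coe] at hl
          refine ⟨?_, ?_⟩
          · rw [← Finset.mem_val, hl]; simp
          · rw [hl]; simp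
      · rintro ⟨j, l⟩ _; rfl

theorem perm_sum_lists {M : Type*} [AddCommMonoid M] (n : ℕ) (F : List (Fin n) → M) :
    ∑ σ : Equiv.Perm (Fin n), F (List.ofFn σ)
      = ∑ l ∈ (Finset.univ : Finset (Fin n)).val.lists.toFinset, F l := by
  have hmem : ∀ l : List (Fin n), l ∈ (Finset.univ : Finset (Fin n)).val.lists.toFinset ↔
      l.Perm (List.finRange n) := by
    intro l
    rw [mem_lst, List.perm_comm, ← Multiset.coe_eq_coe]; rfl
  refine Finset.sum_bij (fun σ _ => List.ofFn σ) ?_ ?_ ?_ ?_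
  · intro σ _
    rw [hmem, List.ofFn_eq_map]
    exact σ.map_finRange_perm
  · intro σ _ τ _ h
    exact Equiv.coe_fn_injective (List.ofFn_injective h)
  · intro l hl
    rw [hmem] at hl
    have hlen : l.length = n := by rw [hl.length_eq]; simp
    have hnd : l.Nodup := hl.nodup_iff.2 (List.nodup_finRange n)
    have hinj : Function.Injective (fun i : Fin n => l.get (i.cast hlen.symm)) := by
      intro i j h
      have := List.nodup_iff_injective_get.1 hnd h
      simpa using this
    refine ⟨Equiv.ofBijective _ (Finite.injective_iff_bijective.1 hinj), Finset.mem_univ _, ?_⟩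
    apply List.ext_get
    · simp [hlen]
    · intro i h1 h2
      simp
  · intro σ _; rfl

end comb

section parts

variable {α : Type*} [DecidableEq α] [Fintype α]

/-- set partitions of a finset -/
def parts (s : Finset α) : Finset (Finset (Finset α)) :=
  Finset.univ.filter fun P =>
    (∅ : Finset α) ∉ P ∧ P.sup id = s ∧ ∀ s ∈ P, ∀ t ∈ P, s ≠ t → Disjoint s t

theorem mem_parts {s : Finset α} {P : Finset (Finset α)} : P ∈ parts s ↔
    (∅ : Finset α) ∉ P ∧ P.sup id = s ∧ ∀ s ∈ P, ∀ t ∈ P, s ≠ t → Disjoint s t := by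
  simp [parts]

theorem parts_empty : parts (∅ : Finset α) = {∅} := by
  ext P
  rw [mem_parts, Finset.mem_singleton]
  constructor
  · rintro ⟨h1, h2, -⟩
    rw [Finset.eq_empty_iff_forall_notMem]
    intro B hB
    have : B ≤ P.sup id := Finset.le_sup (f := id) hB
    rw [h2] at this
    rw [Finset.subset_empty.1 this] at hB
    exact h1 hB
  · rintro rfl; simp

theorem sum_parts_insert {M : Type*} [AddCommMonoid M] (s : Finset α) (a : α) (ha : a ∉ s)
    (F : Finset (Finset α) → M) :
    ∑ P ∈ parts (insert a s), F P
      = ∑ C ∈ s.powerset, ∑ Q ∈ parts (s \ C), F (insert (insert a C) Q) := by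
  have hsub : ∀ {t : Finset α} {P : Finset (Finset α)}, P ∈ parts t → ∀ B ∈ P, B ⊆ t := by
    intro t P hP B hB
    have : B ≤ P.sup id := Finset.le_sup (f := id) hB
    rwa [(mem_parts.1 hP).2.1] at this
  have hnot : ∀ {C : Finset α} {Q : Finset (Finset α)}, Q ∈ parts (s \ C) → ∀ B ∈ Q, a ∉ B := by
    intro C Q hQ B hB haB
    exact ha (Finset.mem_sdiff.1 (hsub hQ B hB haB)).1
  rw [Finset.sum_sigma']
  symm
  refine Finset.sum_bij (fun x _ => insert (insert a x.1) x.2) ?_ ?_ ?_ ?_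
  · rintro ⟨C, Q⟩ hx
    simp only [Finset.mem_sigma, Finset.mem_powerset] at hx
    obtain ⟨hC, hQ⟩ := hx
    obtain ⟨h1, h2, h3⟩ := mem_parts.1 hQ
    have hdis : ∀ B ∈ Q, Disjoint (insert a C) B := by
      intro B hB
      rw [Finset.disjoint_left]
      intro x hx hxB
      rcases Finset.mem_insert.1 hx with rfl | hx
      · exact hnot hQ B hB hxB
      · exact (Finset.mem_sdiff.1 (hsub hQ B hB hxB)).2 hx
    refine mem_parts.2 ⟨?_, ?_, ?_⟩
    · rw [Finset.mem_insert, not_or]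
      exact ⟨(Finset.insert_ne_empty a C).symm, h1⟩
    · rw [Finset.sup_insert, h2]
      simp only [id, Finset.sup_eq_union, Finset.insert_union, Finset.union_sdiff_of_subset hC]
    · intro B hB B' hB' hne
      rcases Finset.mem_insert.1 hB with rfl | hB <;>
        rcases Finset.mem_insert.1 hB' with rfl | hB'
      · exact absurd rfl hne
      · exact hdis _ hB'
      · exact (hdis _ hB).symm
      · exact h3 _ hB _ hB' hne
  · rintro ⟨C, Q⟩ hx ⟨C', Q'⟩ hx' h
    simp only [Finset.mem_sigma, Finset.mem_powerset] at hx hx' h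
    have haC : a ∉ C := fun h => ha (hx.1 h)
    have haC' : a ∉ C' := fun h => ha (hx'.1 h)
    have e : insert a C = insert a C' := by
      have : insert a C ∈ insert (insert a C') Q' := by rw [← h]; exact Finset.mem_insert_self _ _
      rcases Finset.mem_insert.1 this with h | h
      · exact h
      · exact absurd (Finset.mem_insert_self a C) (hnot hx'.2 _ h)
    have eC : C = C' := by
      rw [← Finset.erase_insert haC, e, Finset.erase_insert haC']
    subst eC
    have n1 : insert a C ∉ Q := fun h => hnot hx.2 _ h (Finset.mem_insert_self a C)
    have n2 : insert a C ∉ Q' := fun h => hnot hx'.2 _ h (Finset.mem_insert_self a C)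
    have eQ : Q = Q' := by
      rw [← Finset.erase_insert n1, h, Finset.erase_insert n2]
    subst eQ; rfl
  · intro P hP
    obtain ⟨h1, h2, h3⟩ := mem_parts.1 hP
    obtain ⟨B, hB, haB⟩ : ∃ B ∈ P, a ∈ B := by
      have : a ∈ P.sup id := by rw [h2]; exact Finset.mem_insert_self _ _
      simpa [Finset.mem_sup] using this
    refine ⟨⟨B.erase a, P.erase B⟩, ?_, ?_⟩
    · simp only [Finset.mem_sigma, Finset.mem_powerset]
      refine ⟨?_, mem_parts.2 ⟨fun h => h1 (Finset.mem_of_mem_erase h), ?_, ?_⟩⟩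
      · intro x hx
        have := hsub hP B hB (Finset.mem_of_mem_erase hx)
        exact (Finset.mem_insert.1 this).resolve_left (Finset.ne_of_mem_erase hx)
      · ext x
        simp only [Finset.mem_sup, id, Finset.mem_sdiff, Finset.mem_erase]
        constructor
        · rintro ⟨B', ⟨hne, hB'⟩, hx⟩
          have hd := Finset.disjoint_left.1 (h3 _ hB' _ hB hne) hx
          refine ⟨?_, fun h => hd h.2⟩
          exact (Finset.mem_insert.1 (hsub hP B' hB' hx)).resolve_left
            (by rintro rfl; exact hd haB)
        · rintro ⟨hxs, hxB⟩
          have : x ∈ P.sup id := by rw [h2]; exact Finset.mem_insert_of_mem hxs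
          obtain ⟨B', hB', hx⟩ := Finset.mem_sup.1 this
          refine ⟨B', ⟨?_, hB'⟩, hx⟩
          rintro rfl
          exact hxB ⟨by rintro rfl; exact ha hxs, hx⟩
      · intro B1 hB1 B2 hB2
        exact h3 _ (Finset.mem_of_mem_erase hB1) _ (Finset.mem_of_mem_erase hB2)
    · simp only [Finset.insert_erase haB, Finset.insert_erase hB]
  · rintro ⟨C, Q⟩ _; rfl

theorem notMem_parts {s C : Finset α} {a : α} (ha : a ∉ s) {Q : Finset (Finset α)}
    (hQ : Q ∈ parts (s \ C)) : insert a C ∉ Q := by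
  intro h
  have : insert a C ≤ Q.sup id := Finset.le_sup (f := id) h
  rw [(mem_parts.1 hQ).2.1] at this
  exact ha (Finset.mem_sdiff.1 (this (Finset.mem_insert_self a C))).1

theorem sum_card_parts {s : Finset α} {P : Finset (Finset α)} (hP : P ∈ parts s) :
    ∑ B ∈ P, (B.card - 1) = s.card - P.card := by
  obtain ⟨h1, h2, h3⟩ := mem_parts.1 hP
  have hc : s.card = ∑ B ∈ P, B.card := by
    rw [← h2, Finset.sup_eq_biUnion, Finset.card_biUnion]
    · rfl
    · intro x hx y hy hne; exact h3 x hx y hy hne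
  have : ∑ B ∈ P, B.card = ∑ B ∈ P, (B.card - 1) + P.card := by
    rw [Finset.card_eq_sum_ones, ← Finset.sum_add_distrib]
    refine Finset.sum_congr rfl fun B hB => ?_
    have : 0 < B.card := Finset.card_pos.2 (Finset.nonempty_iff_ne_empty.2
      (by rintro rfl; exact h1 hB))
    omega
  omega

end parts

theorem inr_blockProd {k : Type*} [Field k] {L : Type*} [NonUnitalCommRing L] [Module k L]
    [SMulCommClass k L L] [IsScalarTower k L L] (l : List L) (hl : l ≠ []) :
    (Unitization.inr (blockProd l) : Unitization k L)
      = (l.map (fun a => (Unitization.inr a : Unitization k L))).prod := by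
  cases l with
  | nil => exact absurd rfl hl
  | cons a t =>
    clear hl
    simp only [blockProd]
    induction t generalizing a with
    | nil => simp
    | cons b t ih =>
      rw [List.foldl_cons, ih]
      simp [mul_assoc]

theorem inr_block {k : Type*} [Field k] {L : Type*} [NonUnitalCommRing L] [Module k L]
    [SMulCommClass k L L] [IsScalarTower k L L] {n : ℕ} (u : Fin n → L) (s : Finset (Fin n))
    (hs : s.Nonempty) :
    (Unitization.inr (blockProd ((s.sort (· ≤ ·)).map u)) : Unitization k L)
      = ∏ j ∈ s, (Unitization.inr (u j) : Unitization k L) := by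
  rw [inr_blockProd, List.map_map]
  · have h : ((s.sort (· ≤ ·) : List (Fin n)) : Multiset (Fin n)) = s.val := Finset.sort_eq s _
    rw [Finset.prod, ← h, Multiset.map_coe, Multiset.prod_coe]; rfl
  · intro h
    have := congrArg List.length h
    simp at this
    simp [this] at hs

theorem iterProd_eq {k : Type*} [Field k] {L : Type*} [NonUnitalCommRing L] [Module k L]
    (mr : TensorAlgebra k L →ₗ[k] TensorAlgebra k L →ₗ[k] TensorAlgebra k L)
    (hmrr : ∀ x, mr x 1 = x)
    (R : Multiset L → TensorAlgebra k L) (hR0 : R 0 = 1)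
    (hR : ∀ a s, R (a ::ₘ s) = mr (TensorAlgebra.ι k a) (R s)) (l : List L) :
    iterProd (fun x y => mr x y) (l.map fun a => TensorAlgebra.ι k a) = R l := by
  induction l with
  | nil => simp [iterProd, hR0]
  | cons a t ih =>
    cases t with
    | nil =>
      rw [← Multiset.cons_coe, hR]
      simp [iterProd, hR0, hmrr]
    | cons b t =>
      rw [← Multiset.cons_coe, hR, ← ih]
      simp [iterProd]

theorem T_eq_S {k : Type*} [Field k] {L : Type*} [NonUnitalCommRing L] [Module k L]
    {α : Type*} [DecidableEq α] [Fintype α]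
    {Λ : L → TensorAlgebra k L →ₗ[k] TensorAlgebra k L}
    {S : Finset α → TensorAlgebra k L} {U : Finset α → L} {d : ℕ → k}
    (R : Multiset L → TensorAlgebra k L) (hR0 : R 0 = 1)
    (hR : ∀ a s, R (a ::ₘ s) = Λ a (R s))
    (hS0 : S ∅ = 1)
    (hS : ∀ (V : Finset α) (a : α), a ∉ V →
      S (insert a V) = ∑ C ∈ V.powerset, d C.card • Λ (U (insert a C)) (S (V \ C)))
    (s : Finset α) :
    S s = ∑ P ∈ parts s, (∏ B ∈ P, d (B.card - 1)) • R (P.val.map U) := by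
  induction s using Finset.strongInduction with
  | H s ih =>
    rcases s.eq_empty_or_nonempty with rfl | ⟨a, has⟩
    · simp [parts_empty, hS0, hR0]
    · obtain ⟨V, ha, rfl⟩ : ∃ V, a ∉ V ∧ insert a V = s :=
        ⟨s.erase a, Finset.notMem_erase _ _, Finset.insert_erase has⟩
      rw [hS V a ha, sum_parts_insert V a ha]
      refine Finset.sum_congr rfl fun C hC => ?_
      rw [Finset.mem_powerset] at hC
      have haC : a ∉ C := fun h => ha (hC h)
      rw [ih (V \ C) (Finset.ssubset_of_subset_of_ssubset Finset.sdiff_subset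
        (Finset.ssubset_insert ha)), map_sum, Finset.smul_sum]
      refine Finset.sum_congr rfl fun Q hQ => ?_
      have hn := notMem_parts ha hQ
      rw [Finset.prod_insert hn, Finset.insert_val_of_notMem hn, Multiset.map_cons, hR,
        Finset.card_insert_of_notMem haC, Nat.add_sub_cancel, map_smul, smul_smul]

end SymSum

/--
symmetric sum theorem for interpolated quasi-shuffle products.
For letters `u₁,…,uₙ`,
`Σ_{σ∈Sₙ} u_{σ(1)}⋯u_{σ(n)} = Σ_{B∈Πₙ} c_r(B) · u_{B₁} ∗_r ⋯ ∗_r u_{B_l}`,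
where `u_B = ⋄`-product of the `u_j`, `j ∈ B`, and
`c_r(B) = (−1)^{n−l} Π_m (|B_m|−1)!·p_{|B_m|}(r)`, `p_a(r) = (1−r)^a − (−r)^a`.
Here `mr` is the interpolated product `∗_r`, given by its recursion, and `D a`
is the first-letter `⋄`-action.
-/
theorem stmt16 [CharZero k] (r : k) (n : ℕ) (u : Fin n → L)
    (D : L → TensorAlgebra k L →ₗ[k] TensorAlgebra k L)
    (hD1 : ∀ a : L, D a 1 = 0)
    (hDw : ∀ (a c : L) (v : List L),
      D a (TensorAlgebra.ι k c * word k v) = TensorAlgebra.ι k (a * c) * word k v)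
    (mr : TensorAlgebra k L →ₗ[k] TensorAlgebra k L →ₗ[k] TensorAlgebra k L)
    (hmrl : ∀ x, mr 1 x = x) (hmrr : ∀ x, mr x 1 = x)
    (hmrrec : ∀ (a b : L) (v w : List L),
      mr (word k (a :: v)) (word k (b :: w))
        = TensorAlgebra.ι k a * mr (word k v) (word k (b :: w))
          + TensorAlgebra.ι k b * mr (word k (a :: v)) (word k w)
          + (1 - 2 * r) • (TensorAlgebra.ι k (a * b) * mr (word k v) (word k w))
          + (r ^ 2 - r) • D (a * b) (mr (word k v) (word k w))) :
    ∑ σ : Equiv.Perm (Fin n), word k (List.ofFn fun i => u (σ i))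
      = ∑ P ∈ setPartitions n,
          ((-1 : k) ^ (n - P.card)
              * ∏ s ∈ P, (((s.card - 1).factorial : k)
                  * ((1 - r) ^ s.card - (-r) ^ s.card)))
            • iterProd (fun x y => mr x y)
                (P.toList.map fun s =>
                  TensorAlgebra.ι k (blockProd ((s.sort (· ≤ ·)).map u))) := by
  classical
  have hD : ∀ a c x, D a (TensorAlgebra.ι k c * x) = TensorAlgebra.ι k (a * c) * x := by
    intro a c x
    exact SymSum.ext_word (f := D a ∘ₗ LinearMap.mulLeft k (TensorAlgebra.ι k c))
      (g := LinearMap.mulLeft k (TensorAlgebra.ι k (a * c))) (fun v => hDw a c v) x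
  let Λ : L → TensorAlgebra k L →ₗ[k] TensorAlgebra k L := fun a => mr (TensorAlgebra.ι k a)
  have hΛ1 : ∀ a, Λ a 1 = TensorAlgebra.ι k a := fun a => hmrr _
  have hΛ : ∀ a c x, Λ a (TensorAlgebra.ι k c * x)
      = TensorAlgebra.ι k a * (TensorAlgebra.ι k c * x) + TensorAlgebra.ι k c * Λ a x
        + (1 - 2 * r) • (TensorAlgebra.ι k (a * c) * x) + (r ^ 2 - r) • D (a * c) x := by
    intro a c x
    refine SymSum.ext_word (f := Λ a ∘ₗ LinearMap.mulLeft k (TensorAlgebra.ι k c))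
      (g := LinearMap.mulLeft k (TensorAlgebra.ι k a) ∘ₗ LinearMap.mulLeft k (TensorAlgebra.ι k c)
        + LinearMap.mulLeft k (TensorAlgebra.ι k c) ∘ₗ Λ a
        + (1 - 2 * r) • LinearMap.mulLeft k (TensorAlgebra.ι k (a * c))
        + (r ^ 2 - r) • D (a * c)) (fun v => ?_) x
    have h := hmrrec a c [] v
    simp only [SymSum.word_cons, SymSum.word_nil, hmrl, mul_one] at h
    exact h
  have hIex : ∀ a : L, ∃ O : TensorAlgebra k L →ₗ[k] TensorAlgebra k L,
      O 1 = TensorAlgebra.ι k a ∧ ∀ c x, O (TensorAlgebra.ι k c * x)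
        = TensorAlgebra.ι k a * (TensorAlgebra.ι k c * x) + TensorAlgebra.ι k c * O x := by
    intro a
    exact SymSum.exists_op
      ((LinearMap.compRight k (LinearMap.mulLeft k (TensorAlgebra.ι k a)))
        ∘ₗ (LinearMap.mul k (TensorAlgebra k L)) ∘ₗ TensorAlgebra.ι k) _
  have hJex : ∀ a : L, ∃ O : TensorAlgebra k L →ₗ[k] TensorAlgebra k L,
      O 1 = 0 ∧ ∀ c x, O (TensorAlgebra.ι k c * x)
        = TensorAlgebra.ι k (a * c) * x + TensorAlgebra.ι k c * O x := by
    intro a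
    exact SymSum.exists_op
      ((LinearMap.mul k (TensorAlgebra k L)) ∘ₗ TensorAlgebra.ι k ∘ₗ LinearMap.mulLeft k a) _
  choose I hI1 hI using hIex
  choose J hJ1 hJ using hJex
  have hIc := SymSum.I_comm hI1 hI
  have hJI := SymSum.J_I hI1 hI hJ1 hJ
  have hΛI := SymSum.Λ_I hI1 hI hJ1 hJ hD1 hD hΛ1 hΛ
  have hΛc := SymSum.Λ_comm hD1 hD hΛ1 hΛ
  obtain ⟨S0, hS00, hS0c⟩ := SymSum.exists_fold (fun a x => I a x) hIc 1
  obtain ⟨R, hR0, hR⟩ := SymSum.exists_fold (fun a x => Λ a x) hΛc 1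
  let S : Finset (Fin n) → TensorAlgebra k L := fun s => S0 (s.val.map u)
  have hS0 : S ∅ = 1 := by simp [S, hS00]
  have hS : ∀ a s, a ∉ s → S (insert a s) = I (u a) (S s) := by
    intro a s ha
    simp only [S, Finset.insert_val_of_notMem ha, Multiset.map_cons, hS0c]
  let U : Finset (Fin n) → L := fun s => blockProd ((s.sort (· ≤ ·)).map u)
  have hU1 : ∀ a, U {a} = u a := by
    intro a; simp [U, blockProd]
  have hU : ∀ a s, s.Nonempty → a ∉ s → U (insert a s) = U s * u a := by
    intro a s hs ha
    apply Unitization.inr_injective (R := k)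
    rw [Unitization.inr_mul, SymSum.inr_block u _ (Finset.insert_nonempty a s),
      SymSum.inr_block u _ hs, Finset.prod_insert ha, mul_comm]
  let d : ℕ → k := fun t => (-1) ^ t * ((t.factorial : k) * ((1 - r) ^ (t + 1) - (-r) ^ (t + 1)))
  have hd0 : d 0 = 1 := by simp [d]
  have hd : ∀ t : ℕ, d (t + 1) + (1 - 2 * r) * ((t + 1 : ℕ) * d t)
      + (r ^ 2 - r) * ((t + 1 : ℕ) * (t * d (t - 1))) = 0 := by
    intro t
    cases t with
    | zero => simp [d]; ring
    | succ t =>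
      simp only [d, Nat.add_sub_cancel, Nat.factorial_succ]
      push_cast
      ring
  have hrec := SymSum.S_rec hIc hJI hI1 hJ1 hΛ1 hΛI hS0 hS hU1 hU hd0 hd
  have hTS := SymSum.T_eq_S (Λ := Λ) R hR0 hR hS0 hrec Finset.univ
  have hSf := SymSum.S_first hI1 hI hS0 hS
  have hSl := SymSum.S_lists hS0 hSf Finset.univ
  have hlhs : ∑ σ : Equiv.Perm (Fin n), word k (List.ofFn fun i => u (σ i)) = S Finset.univ := by
    rw [hSl, ← SymSum.perm_sum_lists n (fun l => word k (l.map u))]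
    simp only [List.map_ofFn]
    rfl
  rw [hlhs, hTS]
  refine Finset.sum_congr rfl fun P hP => ?_
  have hc := SymSum.sum_card_parts hP
  rw [Finset.card_univ, Fintype.card_fin] at hc
  congr 1
  · rw [← hc, ← Finset.prod_pow_eq_pow_sum, ← Finset.prod_mul_distrib]
    refine Finset.prod_congr rfl fun B hB => ?_
    have hpos : 0 < B.card := Finset.card_pos.2 (Finset.nonempty_iff_ne_empty.2
      (by rintro rfl; exact (SymSum.mem_parts.1 hP).1 hB))
    simp only [d, Nat.sub_add_cancel hpos]
  · have h := SymSum.iterProd_eq mr hmrr R hR0 hR (P.toList.map U)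
    rw [List.map_map] at h
    rw [← Finset.coe_toList, Multiset.map_coe, ← h]
    rfl
end

section
/- Symmetric sum theorem for multiple zeta values: if k₁,…,kₙ ≥ 2 are integers, then Σ_{σ∈Sₙ} ζ(k_{σ(1)},…,k_{σ(n)}) = Σ_{B={B₁,…,B_l}∈Πₙ} c(B) ∏_{m=1}^{l} ζ(Σ_{j∈B_m} k_j), where c(B) = (−1)^{n−l} ∏_{m=1}^{l} (|B_m|−1)!. -/
/-- The multiple zeta value `ζ(e₁,…,eₙ) = Σ_{n₁>n₂>⋯>nₙ≥1} 1/(n₁^{e₁}⋯nₙ^{eₙ})`,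
as a sum over strictly decreasing tuples of positive integers; for `n = 0`
it equals `1`. -/
noncomputable def mzv {n : ℕ} (e : Fin n → ℕ) : ℝ :=
  ∑' f : {f : Fin n → ℕ // StrictAnti f ∧ ∀ i, 0 < f i},
    ∏ i, (1 : ℝ) / (f.1 i : ℝ) ^ (e i)

noncomputable def zz (k : ℕ) : ℝ := ∑' m : ℕ, (1 : ℝ) / (m : ℝ) ^ k

def prts {N : ℕ} (S : Finset (Fin N)) : Finset (Finset (Finset (Fin N))) :=
  Finset.univ.filter fun P =>
    (∅ : Finset (Fin N)) ∉ P ∧ P.sup id = S ∧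
      ∀ s ∈ P, ∀ t ∈ P, s ≠ t → Disjoint s t

noncomputable def gg {N : ℕ} (e : Fin N → ℕ) (s : Finset (Fin N)) : ℝ :=
  (-1) ^ (s.card - 1) * ((s.card - 1).factorial : ℝ) * zz (∑ j ∈ s, e j)

noncomputable def rr {N : ℕ} (S : Finset (Fin N)) (e : Fin N → ℕ) : ℝ :=
  ∑ P ∈ prts S, ∏ s ∈ P, gg e s

lemma mem_prts {N : ℕ} {S : Finset (Fin N)} {P : Finset (Finset (Fin N))} :
    P ∈ prts S ↔ (∅ : Finset (Fin N)) ∉ P ∧ (∀ x, x ∈ S ↔ ∃ s ∈ P, x ∈ s) ∧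
      ∀ s ∈ P, ∀ t ∈ P, ∀ x, x ∈ s → x ∈ t → s = t := by
  unfold prts
  simp only [Finset.mem_filter, Finset.mem_univ, true_and, Finset.ext_iff, Finset.mem_sup, id]
  refine and_congr Iff.rfl (and_congr ?_ ?_)
  · exact forall_congr' fun x => Iff.comm
  · refine forall₄_congr fun s hs t ht => ?_
    rw [← not_imp_not, not_not, Finset.not_disjoint_iff]
    simp only [← Finset.ext_iff]
    grind

lemma prts_sum {N : ℕ} (S : Finset (Fin N)) (a : Fin N) (ha : a ∉ S)
    (F : Finset (Finset (Fin N)) → ℝ) :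
    ∑ P ∈ prts (insert a S), F P = ∑ Q ∈ prts S, F (insert {a} Q)
      + ∑ Q ∈ prts S, ∑ s ∈ Q, F (insert (insert a s) (Q.erase s)) := by
  rw [← Finset.sum_filter_add_sum_filter_not (prts (insert a S)) (fun P => {a} ∈ P)]
  congr 1
  · symm
    refine Finset.sum_bij' (fun Q _ => insert {a} Q) (fun P _ => P.erase {a}) ?_ ?_ ?_ ?_ ?_
    · intro Q hQ
      simp only [Finset.mem_filter, mem_prts] at *
      grind
    · intro P hP
      simp only [Finset.mem_filter, mem_prts] at *
      obtain ⟨⟨h1, h2, h3⟩, h4⟩ := hP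
      refine ⟨by grind, fun x => ?_, by grind⟩
      have := h2 x
      have := h3 {a} h4
      grind
    · intro Q hQ
      simp only [mem_prts] at hQ
      apply Finset.erase_insert
      grind
    · intro P hP
      simp only [Finset.mem_filter] at hP
      exact Finset.insert_erase hP.2
    · intros; rfl
  · rw [Finset.sum_sigma']
    symm
    have key : ∀ Q ∈ prts S, ∀ s ∈ Q, insert a s ∉ Q.erase s ∧ ∀ t ∈ Q, a ∉ t := by
      intro Q hQ s hs
      simp only [mem_prts] at hQ
      grind
    refine Finset.sum_bij (fun x _ => insert (insert a x.2) (x.1.erase x.2)) ?_ ?_ ?_ ?_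
    · rintro ⟨Q, s⟩ hQ
      simp only [Finset.mem_filter, Finset.mem_sigma] at *
      obtain ⟨k1, k2⟩ := key Q hQ.1 s hQ.2
      simp only [mem_prts] at *
      obtain ⟨⟨h1, h2, h3⟩, h4⟩ := hQ
      have hne : s.Nonempty := by
        rw [Finset.nonempty_iff_ne_empty]; rintro rfl; exact h1 h4
      obtain ⟨y, hy⟩ := hne
      refine ⟨⟨by grind, fun x => ?_, ?_⟩, ?_⟩
      · constructor
        · intro hx
          rcases Finset.mem_insert.1 hx with rfl | hx
          · exact ⟨_, Finset.mem_insert_self _ _, by simp⟩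
          · obtain ⟨t, ht, hxt⟩ := (h2 x).1 hx
            by_cases hts : t = s
            · exact ⟨_, Finset.mem_insert_self _ _, by simp [← hts, hxt]⟩
            · exact ⟨t, by simp [ht, hts], hxt⟩
        · rintro ⟨t, ht, hxt⟩
          have := h2 x
          grind
      · intro t ht u hu x hxt hxu
        have := h3 s h4
        simp only [Finset.mem_insert, Finset.mem_erase] at ht hu
        grind
      · intro h
        simp only [Finset.mem_insert, Finset.mem_erase] at h
        grind
    · rintro ⟨Q, s⟩ hQ ⟨Q', s'⟩ hQ' h
      simp only [Finset.mem_sigma] at *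
      obtain ⟨k1, k2⟩ := key Q hQ.1 s hQ.2
      obtain ⟨k1', k2'⟩ := key Q' hQ'.1 s' hQ'.2
      have e1 : insert a s = insert a s' := by
        have : insert a s ∈ insert (insert a s') (Q'.erase s') := by
          rw [← h]; exact Finset.mem_insert_self _ _
        grind
      have e2 : s = s' := by
        rw [← Finset.erase_insert (k2 s hQ.2), e1, Finset.erase_insert (k2' s' hQ'.2)]
      subst e2
      have e3 : Q.erase s = Q'.erase s := by
        rw [← Finset.erase_insert k1, h, Finset.erase_insert k1']
      have e4 : Q = Q' := by
        rw [← Finset.insert_erase hQ.2, e3, Finset.insert_erase hQ'.2]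
      subst e4; rfl
    · intro P hP
      simp only [Finset.mem_filter, mem_prts] at hP
      obtain ⟨⟨h1, h2, h3⟩, h4⟩ := hP
      obtain ⟨t, ht, hat⟩ := (h2 a).1 (by simp)
      have hs : t.erase a ∉ P := by
        intro h
        have hne : (t.erase a).Nonempty := by
          rw [Finset.nonempty_iff_ne_empty]; intro h0; exact h1 (h0 ▸ h)
        obtain ⟨y, hy⟩ := hne
        have := h3 _ h t ht y hy (Finset.mem_of_mem_erase hy)
        rw [← this] at hat
        simp at hat
      refine ⟨⟨insert (t.erase a) (P.erase t), t.erase a⟩, ?_, ?_⟩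
      · simp only [Finset.mem_sigma, mem_prts]
        refine ⟨⟨?_, fun x => ?_, ?_⟩, by simp⟩
        · intro h
          simp only [Finset.mem_insert, Finset.mem_erase] at h
          rcases h with h | h
          · apply h4
            have : t = {a} := by
              rw [← Finset.insert_erase hat, ← h]; rfl
            exact this ▸ ht
          · exact h1 h.2
        · have h2x := h2 x
          constructor
          · intro hx
            obtain ⟨u, hu, hxu⟩ := h2x.1 (by simp [hx])
            by_cases hut : u = t
            · subst hut
              exact ⟨_, Finset.mem_insert_self _ _, by grind⟩
            · exact ⟨u, by simp [hu, hut], hxu⟩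
          · rintro ⟨u, hu, hxu⟩
            have := h3 t ht
            simp only [Finset.mem_insert, Finset.mem_erase] at hu
            grind
        · intro u hu v hv x hxu hxv
          have := h3 t ht
          simp only [Finset.mem_insert, Finset.mem_erase] at hu hv
          grind
      · simp only
        rw [Finset.erase_insert (by simp [hs]), Finset.insert_erase hat, Finset.insert_erase ht]
    · intros; rfl

lemma rr_step {N : ℕ} (S : Finset (Fin N)) (a : Fin N) (ha : a ∉ S) (e : Fin N → ℕ) :
    rr (insert a S) e = zz (e a) * rr S e
      - ∑ i ∈ S, rr S (Function.update e i (e i + e a)) := by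
  unfold rr
  rw [prts_sum S a ha, Finset.mul_sum, Finset.sum_comm, sub_eq_add_neg, ← Finset.sum_neg_distrib]
  congr 1
  · refine Finset.sum_congr rfl fun Q hQ => ?_
    rw [Finset.prod_insert]
    · simp [gg]
    · simp only [mem_prts] at hQ
      grind
  · refine Finset.sum_congr rfl fun Q hQ => ?_
    simp only [mem_prts] at hQ
    obtain ⟨h1, h2, h3⟩ := hQ
    have hS : S = Q.biUnion id := by
      ext x; simp [h2 x]
    have hd : (Q : Set (Finset (Fin N))).PairwiseDisjoint id := by
      intro s hs t ht hst
      simp only [Function.onFun, id]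
      rw [Finset.disjoint_left]
      intro x hx hx'
      exact hst (h3 s hs t ht x hx hx')
    rw [hS, Finset.sum_biUnion hd, ← Finset.sum_neg_distrib]
    refine Finset.sum_congr rfl fun s hs => ?_
    have hne : s.Nonempty := by
      rw [Finset.nonempty_iff_ne_empty]; rintro rfl; exact h1 hs
    have has : a ∉ s := by grind
    rw [Finset.prod_insert (by grind)]
    have : ∀ i ∈ id s, ∏ t ∈ Q, gg (Function.update e i (e i + e a)) t
        = ((-1) ^ (s.card - 1) * ((s.card - 1).factorial : ℝ) * zz (∑ j ∈ insert a s, e j))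
          * ∏ t ∈ Q.erase s, gg e t := by
      intro i hi
      simp only [id] at hi
      rw [← Finset.mul_prod_erase _ _ hs]
      congr 1
      · unfold gg
        congr 2
        rw [Finset.sum_update_of_mem hi, Finset.sum_insert has,
          ← Finset.add_sum_erase _ _ hi, Finset.sdiff_singleton_eq_erase]
        ring
      · refine Finset.prod_congr rfl fun t ht => ?_
        unfold gg
        congr 2
        refine Finset.sum_congr rfl fun j hj => ?_
        rw [Function.update_of_ne]
        rintro rfl
        rw [Finset.mem_erase] at ht
        exact ht.1 (h3 t ht.2 s hs j hj hi)
    rw [Finset.sum_congr rfl this, Finset.sum_const, nsmul_eq_mul]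
    unfold gg
    rw [Finset.card_insert_of_notMem has]
    simp only [id]
    obtain ⟨c, hc⟩ : ∃ c, s.card = c + 1 := ⟨s.card - 1, by have := hne.card_pos; omega⟩
    rw [hc]
    simp only [Nat.add_sub_cancel, Nat.factorial_succ]
    push_cast
    ring

noncomputable def tt {n : ℕ} (e : Fin n → ℕ) (f : Fin n → ℕ) : ℝ :=
  ∏ i, (1 : ℝ) / (f i : ℝ) ^ (e i)

open Classical in
noncomputable def aa {n : ℕ} (e : Fin n → ℕ) : ℝ :=
  ∑' f : Fin n → ℕ, if Function.Injective f then tt e f else 0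

lemma tt_nonneg {n : ℕ} (e : Fin n → ℕ) (f : Fin n → ℕ) : 0 ≤ tt e f :=
  Finset.prod_nonneg fun i _ => by positivity

lemma summable_one {k : ℕ} (hk : 2 ≤ k) : Summable fun m : ℕ => (1 : ℝ) / (m : ℝ) ^ k :=
  Real.summable_one_div_nat_pow.2 (by omega)

lemma summable_tt {n : ℕ} (e : Fin n → ℕ) (he : ∀ i, 2 ≤ e i) : Summable (tt e) := by
  induction n with
  | zero => exact Summable.of_finite
  | succ n ih =>
    rw [← (Fin.consEquiv (fun _ : Fin (n+1) => ℕ)).summable_iff]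
    have := (summable_one (he 0)).mul_of_nonneg (ih (fun i => e i.succ) (fun i => he _))
      (fun m => by positivity) (fun f => tt_nonneg _ f)
    refine this.congr fun x => ?_
    simp [tt, Fin.consEquiv, Fin.prod_univ_succ, mul_comm]

open Classical in
lemma summable_inj {n : ℕ} (e : Fin n → ℕ) (he : ∀ i, 2 ≤ e i) :
    Summable fun f : Fin n → ℕ => if Function.Injective f then tt e f else 0 := by
  refine Summable.of_nonneg_of_le (fun f => ?_) (fun f => ?_) (summable_tt e he)
  · split_ifs; exacts [tt_nonneg _ _, le_rfl]
  · split_ifs; exacts [le_rfl, tt_nonneg _ _]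

open Classical in
lemma hasSum_diag {n : ℕ} (e : Fin n → ℕ) (he : ∀ i, 2 ≤ e i) (a : ℕ) (i : Fin n) :
    HasSum (fun x : ℕ × (Fin n → ℕ) => if x.1 = x.2 i then
        (1 : ℝ) / (x.1 : ℝ) ^ a * (if Function.Injective x.2 then tt e x.2 else 0) else 0)
      (aa (Function.update e i (e i + a))) := by
  have h := (summable_inj (Function.update e i (e i + a)) (fun j => by
    have := he j
    by_cases h : j = i
    · subst h; simp; omega
    · simpa [h] using this)).hasSum
  have hinj : Function.Injective (fun f : Fin n → ℕ => (f i, f)) := fun f g h => (Prod.ext_iff.1 h).2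
  rw [← hinj.hasSum_iff]
  · unfold aa
    convert h using 2 with f
    simp only [Function.comp, if_true]
    split_ifs
    · unfold tt
      rw [← Finset.mul_prod_erase _ _ (Finset.mem_univ i),
        ← Finset.mul_prod_erase _ _ (Finset.mem_univ i), ← mul_assoc]
      congr 1
      · simp [pow_add, mul_comm]
      · refine Finset.prod_congr rfl fun j hj => ?_
        rw [Function.update_of_ne (Finset.ne_of_mem_erase hj)]
    · simp
  · rintro ⟨m, f⟩ hx
    rw [if_neg]
    rintro h
    exact hx ⟨f, by simp at h; simp [h]⟩

open Classical in
lemma aa_step {n : ℕ} (e : Fin (n + 1) → ℕ) (he : ∀ i, 2 ≤ e i) :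
    aa e = zz (e 0) * aa (fun i : Fin n => e i.succ)
      - ∑ i : Fin n, aa (Function.update (fun i : Fin n => e i.succ) i (e i.succ + e 0)) := by
  have he' : ∀ i : Fin n, 2 ≤ (fun i : Fin n => e i.succ) i := fun i => he _
  have s1 := (summable_one (he 0))
  have s2 := summable_inj _ he'
  have s3 := s1.mul_of_nonneg s2 (fun m => by positivity) (fun f => by
    simp only [Pi.zero_apply]
    split_ifs; exacts [tt_nonneg _ _, le_rfl])
  have h1 := s1.hasSum.mul s2.hasSum s3
  have h2 := hasSum_sum (s := Finset.univ) fun i _ =>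
    hasSum_diag (fun i : Fin n => e i.succ) he' (e 0) i
  have h3 := h1.sub h2
  refine HasSum.tsum_eq ?_
  rw [← (Fin.consEquiv (fun _ : Fin (n+1) => ℕ)).hasSum_iff]
  refine (congrArg (fun F => HasSum F _) (funext fun x => ?_)).mpr h3
  obtain ⟨m, f⟩ := x
  simp only [Function.comp, Fin.consEquiv, Equiv.coe_fn_mk]
  simp only [Fin.cons_injective_iff]
  by_cases hf : Function.Injective f
  · by_cases hm : m ∈ Set.range f
    · obtain ⟨i, rfl⟩ := hm
      rw [if_neg (by simp), if_pos hf]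
      simp only [hf.eq_iff]
      simp
    · rw [if_pos ⟨hm, hf⟩, if_pos hf, Finset.sum_eq_zero]
      · simp [tt, Fin.prod_univ_succ, mul_comm]
      · intro i _
        rw [if_neg]
        rintro rfl
        exact hm ⟨i, rfl⟩
  · simp [hf]

lemma aa_eq_rr {N : ℕ} : ∀ (n : ℕ) (ι : Fin n ↪ Fin N) (e : Fin N → ℕ) (_ : ∀ i, 2 ≤ e i),
    aa (fun i => e (ι i)) = rr (Finset.univ.map ι) e := by
  intro n
  induction n with
  | zero =>
    intro ι e he
    have h : prts (∅ : Finset (Fin N)) = {∅} := by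
      ext P
      rw [mem_prts, Finset.mem_singleton]
      constructor
      · rintro ⟨h1, h2, -⟩
        rw [Finset.eq_empty_iff_forall_notMem]
        intro s hs
        rcases s.eq_empty_or_nonempty with rfl | ⟨x, hx⟩
        · exact h1 hs
        · simpa using (h2 x).2 ⟨s, hs, hx⟩
      · rintro rfl; simp
    simp [aa, rr, h, tt, Function.injective_of_subsingleton]
  | succ n ih =>
    intro ι e he
    let κ : Fin n ↪ Fin N := (Fin.succEmb n).trans ι
    have hS : Finset.univ.map ι = insert (ι 0) (Finset.univ.map κ) := by
      ext x; simp [κ, Fin.exists_fin_succ, eq_comm]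
    have h0 : ι 0 ∉ Finset.univ.map κ := by simp [κ]
    rw [hS, rr_step _ _ h0, aa_step _ (fun i => he _), Finset.sum_map, ← ih κ e he]
    congr 1
    refine Finset.sum_congr rfl fun i _ => ?_
    rw [← ih κ]
    · congr 1
      exact (Function.update_comp_eq_of_injective e κ.injective i _).symm
    · intro j
      have := he j
      by_cases h : j = κ i
      · subst h; simp; omega
      · simpa [h] using this

lemma mzv_one {k : ℕ} (hk : 2 ≤ k) : mzv (fun _ : Fin 1 => k) = zz k := by
  unfold mzv zz
  let g : {f : Fin 1 → ℕ // StrictAnti f ∧ ∀ i, 0 < f i} → ℕ := fun f => f.1 0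
  have hg : Function.Injective g := by
    intro f f' h
    apply Subtype.ext
    funext i
    rw [Subsingleton.elim i 0]; exact h
  rw [← hg.tsum_eq]
  · simp [g]
  · intro m hm
    have hm0 : m ≠ 0 := by
      rintro rfl
      apply hm
      simp; omega
    exact ⟨⟨fun _ => m, Subsingleton.strictAnti _, fun _ => Nat.pos_of_ne_zero hm0⟩, rfl⟩

open Classical in
lemma sum_mzv {n : ℕ} (e : Fin n → ℕ) (he : ∀ i, 2 ≤ e i) :
    ∑ σ : Equiv.Perm (Fin n), mzv (e ∘ σ) = aa e := by
  let X := {f : Fin n → ℕ // StrictAnti f ∧ ∀ i, 0 < f i}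
  let g : Equiv.Perm (Fin n) × X → (Fin n → ℕ) := fun x => x.2.1 ∘ x.1.symm
  have hg : Function.Injective g := by
    rintro ⟨σ, f, hf, hf'⟩ ⟨τ, f', hh, hh'⟩ h
    simp only [g] at h
    have hr : Set.range (f ∘ Fin.rev) = Set.range (f' ∘ Fin.rev) := by
      have := congrArg Set.range h
      rw [σ.symm.surjective.range_comp, τ.symm.surjective.range_comp] at this
      rw [Fin.rev_surjective.range_comp, Fin.rev_surjective.range_comp, this]
    have e1 := (StrictMono.range_inj (hf.comp Fin.rev_strictAnti) (hh.comp Fin.rev_strictAnti)).1 hr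
    have e2 : f = f' := by
      funext i
      simpa using congrFun e1 i.rev
    subst e2
    have : σ.symm = τ.symm := by
      ext i
      rw [hf.injective (congrFun h i)]
    have : σ = τ := by rw [← σ.symm_symm, this, τ.symm_symm]
    subst this; rfl
  have hgi : ∀ x, Function.Injective (g x) := fun x =>
    x.2.2.1.injective.comp x.1.symm.injective
  unfold aa
  have hs := summable_inj e he
  have hsupp : Function.support (fun f : Fin n → ℕ => if Function.Injective f then tt e f else 0)
      ⊆ Set.range g := by
    intro f hf
    simp only [Function.mem_support, ne_eq, ite_eq_right_iff, Classical.not_imp] at hf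
    obtain ⟨hi, ht⟩ := hf
    have hpos : ∀ i, 0 < f i := by
      intro i
      by_contra h0
      apply ht
      refine Finset.prod_eq_zero (Finset.mem_univ i) ?_
      have := he i
      have h0 : f i = 0 := by omega
      simp [h0]; omega
    have hm : StrictMono (f ∘ Tuple.sort f) :=
      (Tuple.monotone_sort f).strictMono_of_injective (hi.comp (Tuple.sort f).injective)
    refine ⟨⟨Fin.revPerm.trans (Tuple.sort f), ⟨f ∘ Tuple.sort f ∘ Fin.rev, ?_, fun i => hpos _⟩⟩, ?_⟩
    · exact hm.comp_strictAnti Fin.rev_strictAnti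
    · funext i
      simp [g]
  rw [← hg.tsum_eq hsupp]
  have hs' := hs.comp_injective hg
  have := hs'.tsum_prod
  simp only [Function.comp] at this
  rw [this, tsum_fintype]
  refine Finset.sum_congr rfl fun σ _ => ?_
  unfold mzv
  refine tsum_congr fun f => ?_
  rw [if_pos (hgi _)]
  simp only [tt, g, Function.comp]
  rw [← Equiv.prod_comp σ (fun i => (1 : ℝ) / (f.1 (σ.symm i) : ℝ) ^ e i)]
  simp


/-- symmetric sum theorem for multiple zeta values.
If `k₁,…,kₙ ≥ 2`, then `Σ_{σ∈Sₙ} ζ(k_{σ(1)},…,k_{σ(n)})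
= Σ_{B∈Πₙ} c(B) Π_{s∈B} ζ(Σ_{j∈s} k_j)` with
`c(B) = (−1)^{n−|B|} Π_{s∈B} (|s|−1)!`. -/
theorem stmt19 (n : ℕ) (e : Fin n → ℕ) (he : ∀ i, 2 ≤ e i) :
    ∑ σ : Equiv.Perm (Fin n), mzv (e ∘ σ)
      = ∑ P ∈ setPartitions n,
          ((-1 : ℝ) ^ (n - P.card) * ∏ s ∈ P, ((s.card - 1).factorial : ℝ))
            * ∏ s ∈ P, mzv (fun _ : Fin 1 => ∑ j ∈ s, e j) := by
  rw [sum_mzv e he]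
  have h := aa_eq_rr n (Function.Embedding.refl _) e he
  simp only [Function.Embedding.refl_apply, Finset.map_refl] at h
  rw [h]
  unfold rr
  refine Finset.sum_congr rfl fun P hP => ?_
  have hP' := mem_prts.1 hP
  obtain ⟨h1, h2, h3⟩ := hP'
  have hne : ∀ s ∈ P, s.Nonempty := by
    intro s hs
    rw [Finset.nonempty_iff_ne_empty]; rintro rfl; exact h1 hs
  have hz : ∀ s ∈ P, mzv (fun _ : Fin 1 => ∑ j ∈ s, e j) = zz (∑ j ∈ s, e j) := by
    intro s hs
    obtain ⟨x, hx⟩ := hne s hs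
    exact mzv_one ((he x).trans (Finset.single_le_sum (f := e) (fun _ _ => Nat.zero_le _) hx))
  rw [Finset.prod_congr rfl hz]
  unfold gg
  rw [Finset.prod_mul_distrib, Finset.prod_mul_distrib, Finset.prod_pow_eq_pow_sum]
  congr 3
  have hcard : ∑ s ∈ P, s.card = n := by
    have hd : (P : Set (Finset (Fin n))).PairwiseDisjoint id := by
      intro s hs t ht hst
      simp only [Function.onFun, id]
      rw [Finset.disjoint_left]
      intro x hx hx'
      exact hst (h3 s hs t ht x hx hx')
    have hu : P.biUnion id = Finset.univ := by
      ext x; simpa using h2 x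
    have := Finset.card_biUnion hd
    rw [hu] at this
    simpa using this.symm
  have h4 : ∑ s ∈ P, (s.card - 1) + P.card = n := by
    rw [Finset.card_eq_sum_ones, ← Finset.sum_add_distrib]
    conv_rhs => rw [← hcard]
    refine Finset.sum_congr rfl fun s hs => ?_
    have := (hne s hs).card_pos
    omega
  omega
end
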